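/- Let m ≥ 2 be an integer and let p be a real number with m < p < 2m. Suppose C ≥ 1 is a constant such that for every positive integer n and every m-linear form T : ℓ_p^n × ⋯ × ℓ_p^n → 𝕂, (∑_{j_1,…,j_m=1}^n |T(e_{j_1},…,e_{j_m})|^{p/(p−m)})^{(p−m)/p} ≤ C‖T‖. Then for every positive integer n and every m-homogeneous polynomial P(x) = ∑_{|α|=m} a_α x^α on ℓ_p^n one has (∑_{|α|=m} |a_α|^{p/(p−m)})^{(p−m)/p} ≤ C · m^m/(m!)^{(p−m)/p} · ‖P‖. -/

import Mathlib

open scoped BigOperators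

/-- The `ℓ_p` norm of a vector in `𝕂^n`: `(∑ i, ‖x i‖^p)^(1/p)`. -/
noncomputable def lpNorm (𝕂 : Type*) [RCLike 𝕂] (p : ℝ) {n : ℕ} (x : Fin n → 𝕂) : ℝ :=
  (∑ i, ‖x i‖ ^ p) ^ (1 / p)

/-- The sup norm of an `m`-linear form on `ℓ_p^n × ⋯ × ℓ_p^n`. -/
noncomputable def multilinearNorm (𝕂 : Type*) [RCLike 𝕂] (p : ℝ) {m n : ℕ}
    (T : MultilinearMap 𝕂 (fun _ : Fin m => Fin n → 𝕂) 𝕂) : ℝ :=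
  sSup {t : ℝ | ∃ x : Fin m → Fin n → 𝕂, (∀ k, lpNorm 𝕂 p (x k) ≤ 1) ∧ t = ‖T x‖}

/-- The sup norm of a polynomial on the unit ball of `ℓ_p^n`. -/
noncomputable def polyNorm (𝕂 : Type*) [RCLike 𝕂] (p : ℝ) {n : ℕ}
    (P : MvPolynomial (Fin n) 𝕂) : ℝ :=
  sSup {t : ℝ | ∃ x : Fin n → 𝕂, lpNorm 𝕂 p x ≤ 1 ∧ t = ‖MvPolynomial.eval x P‖}

/-- Every multi-index of degree `m` is the type of some `m`-tuple of indices. -/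
theorem exists_sum_single_eq {σ : Type*} {m : ℕ} (α : σ →₀ ℕ) (h : α.degree = m) :
    ∃ f : Fin m → σ, ∑ k, Finsupp.single (f k) 1 = α := by
  classical
  induction m generalizing α with
  | zero => exact ⟨Fin.elim0, by simp [(Finsupp.degree_eq_zero_iff α).1 h]⟩
  | succ m ih =>
    obtain ⟨i, hi⟩ : ∃ i, α i ≠ 0 := by
      by_contra! h0
      have : α = 0 := Finsupp.ext h0
      simp [this] at h
    have hle : Finsupp.single i 1 ≤ α := by
      rw [Finsupp.single_le_iff]; omega
    obtain ⟨β, rfl⟩ := exists_add_of_le hle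
    rw [map_add, Finsupp.degree_single] at h
    obtain ⟨f, rfl⟩ := ih β (by omega)
    exact ⟨Fin.cons i f, by simp [Fin.sum_univ_succ]⟩

/-- The signed sum `∑ ε, (∏ ε k) * (∏ ε (s k))` over all choices of signs detects bijections. -/
theorem sum_signs_prod_mul_prod_comp {ι R : Type*} [Fintype ι] [DecidableEq ι] [CommRing R]
    (s : ι → ι) :
    ∑ ε : ι → ℤˣ, (∏ k, ((ε k : ℤ) : R)) * ∏ k, ((ε (s k) : ℤ) : R)
      = if Function.Bijective s then 2 ^ Fintype.card ι else 0 := by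
  have hsq (u : ℤˣ) : ((u : ℤ) : R) * ((u : ℤ) : R) = 1 := by
    rw [← Int.cast_mul, ← Units.val_mul, Int.units_mul_self]; simp
  split_ifs with hs
  · have (ε : ι → ℤˣ) : ∏ k, ((ε (s k) : ℤ) : R) = ∏ k, ((ε k : ℤ) : R) :=
      hs.prod_comp (fun k => ((ε k : ℤ) : R))
    simp [this, ← Finset.prod_mul_distrib, hsq]
  · have hsurj : ¬ Function.Surjective s := fun h => hs (Finite.surjective_iff_bijective.1 h)
    obtain ⟨l, hl⟩ : ∃ l, ∀ k, s k ≠ l := by simpa [Function.Surjective] using hsurj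
    have key (ε : ι → ℤˣ) : (∏ k, ((ε k : ℤ) : R)) * ∏ k, ((ε (s k) : ℤ) : R)
        = ∏ i, (((ε i : ℤ) : R) * ((ε i : ℤ) : R) ^ (Finset.univ.filter (s · = i)).card) := by
      rw [Finset.prod_mul_distrib]
      congr 1
      rw [← Finset.prod_fiberwise (Finset.univ) s]
      refine Finset.prod_congr rfl fun i _ => ?_
      rw [Finset.prod_congr rfl (g := fun _ => ((ε i : ℤ) : R)), Finset.prod_const]
      intro k hk
      rw [(Finset.mem_filter.1 hk).2]
    simp_rw [key]
    rw [← Fintype.prod_sum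
      (fun i (u : ℤˣ) => ((u : ℤ) : R) * ((u : ℤ) : R) ^ (Finset.univ.filter (s · = i)).card)]
    refine Finset.prod_eq_zero (Finset.mem_univ l) ?_
    simp [hl]

/-- Glynn's formula: the polarization identity for a product of linear forms. -/
theorem sum_signs_prod_mul_prod_sum {ι R : Type*} [Fintype ι] [DecidableEq ι] [CommRing R]
    (A : ι → ι → R) :
    ∑ ε : ι → ℤˣ, (∏ k, ((ε k : ℤ) : R)) * ∏ k, ∑ l, ((ε l : ℤ) : R) * A l k
      = 2 ^ Fintype.card ι * ∑ σ : Equiv.Perm ι, ∏ k, A (σ k) k := by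
  simp_rw [Fintype.prod_sum, Finset.mul_sum, Finset.prod_mul_distrib, ← mul_assoc]
  rw [Finset.sum_comm]
  simp_rw [← Finset.sum_mul, sum_signs_prod_mul_prod_comp, ite_mul, zero_mul]
  rw [← Finset.sum_filter]
  symm
  refine Finset.sum_bij (fun σ _ => ⇑σ) ?_ ?_ ?_ ?_
  · intro σ _; simp
  · intro σ _ τ _ h; exact DFunLike.coe_injective h
  · intro s hs
    exact ⟨Equiv.ofBijective s (Finset.mem_filter.1 hs).2, Finset.mem_univ _, rfl⟩
  · intro σ _; rfl

theorem lpNorm_le_one_iff {𝕂 : Type*} [RCLike 𝕂] {p : ℝ} (hp : 0 < p) {n : ℕ} (x : Fin n → 𝕂) :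
    lpNorm 𝕂 p x ≤ 1 ↔ ∑ i, ‖x i‖ ^ p ≤ 1 := by
  have h0 : 0 ≤ ∑ i, ‖x i‖ ^ p := Finset.sum_nonneg fun i _ => by positivity
  have h := Real.rpow_le_rpow_iff h0 zero_le_one (one_div_pos.2 hp)
  rwa [Real.one_rpow] at h

theorem norm_apply_le_one_of_lpNorm_le_one {𝕂 : Type*} [RCLike 𝕂] {p : ℝ} (hp : 0 < p) {n : ℕ}
    {x : Fin n → 𝕂} (hx : lpNorm 𝕂 p x ≤ 1) (i : Fin n) : ‖x i‖ ≤ 1 := by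
  rw [lpNorm_le_one_iff hp] at hx
  have h : ‖x i‖ ^ p ≤ 1 :=
    (Finset.single_le_sum (f := fun i => ‖x i‖ ^ p) (fun i _ => by positivity)
      (Finset.mem_univ i)).trans hx
  by_contra! hlt
  exact absurd h (not_le.2 (Real.one_lt_rpow hlt hp))

theorem lpNorm_average_le_one {𝕂 : Type*} [RCLike 𝕂] {p : ℝ} (hp : 1 ≤ p) {m n : ℕ} (hm : 0 < m)
    (x : Fin m → Fin n → 𝕂) (hx : ∀ k, lpNorm 𝕂 p (x k) ≤ 1) (ε : Fin m → ℤˣ) :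
    lpNorm 𝕂 p (fun i => (m : 𝕂)⁻¹ * ∑ k, ((ε k : ℤ) : 𝕂) * x k i) ≤ 1 := by
  have hm' : (0 : ℝ) < m := by exact_mod_cast hm
  have hp0 : 0 < p := by linarith
  rw [lpNorm_le_one_iff hp0]
  have hε (k : Fin m) : ‖((ε k : ℤ) : 𝕂)‖ = 1 := by
    rcases Int.units_eq_one_or (ε k) with h | h <;> simp [h]
  have hi (i : Fin n) : ‖(m : 𝕂)⁻¹ * ∑ k, ((ε k : ℤ) : 𝕂) * x k i‖ ^ p
      ≤ ∑ k, (m : ℝ)⁻¹ * ‖x k i‖ ^ p := by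
    have h1 : ‖(m : 𝕂)⁻¹ * ∑ k, ((ε k : ℤ) : 𝕂) * x k i‖ ≤ ∑ k, (m : ℝ)⁻¹ * ‖x k i‖ := by
      rw [norm_mul, norm_inv, RCLike.norm_natCast, ← Finset.mul_sum]
      gcongr
      refine (norm_sum_le _ _).trans_eq ?_
      simp [hε]
    refine (Real.rpow_le_rpow (norm_nonneg _) h1 hp0.le).trans ?_
    exact Real.rpow_arith_mean_le_arith_mean_rpow _ _ _ (fun _ _ => by positivity)
      (by simp [hm'.ne']) (fun _ _ => norm_nonneg _) hp
  calc _ ≤ ∑ i, ∑ k, (m : ℝ)⁻¹ * ‖x k i‖ ^ p := Finset.sum_le_sum fun i _ => hi i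
    _ = ∑ k, (m : ℝ)⁻¹ * ∑ i, ‖x k i‖ ^ p := by
      rw [Finset.sum_comm]; simp_rw [Finset.mul_sum]
    _ ≤ ∑ k : Fin m, (m : ℝ)⁻¹ * 1 := by
      gcongr with k
      exact (lpNorm_le_one_iff hp0 _).1 (hx k)
    _ = 1 := by simp [hm'.ne']

theorem polyNorm_nonneg {𝕂 : Type*} [RCLike 𝕂] (p : ℝ) {n : ℕ} (P : MvPolynomial (Fin n) 𝕂) :
    0 ≤ polyNorm 𝕂 p P := by
  refine Real.sSup_nonneg ?_
  rintro _ ⟨x, -, rfl⟩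
  exact norm_nonneg _

theorem norm_eval_le_polyNorm {𝕂 : Type*} [RCLike 𝕂] {p : ℝ} (hp : 0 < p) {n : ℕ}
    (P : MvPolynomial (Fin n) 𝕂) {x : Fin n → 𝕂} (hx : lpNorm 𝕂 p x ≤ 1) :
    ‖MvPolynomial.eval x P‖ ≤ polyNorm 𝕂 p P := by
  refine le_csSup ⟨∑ α ∈ P.support, ‖P.coeff α‖, ?_⟩ ⟨x, hx, rfl⟩
  rintro _ ⟨y, hy, rfl⟩
  rw [MvPolynomial.eval_eq]
  refine norm_sum_le_of_le _ fun α _ => ?_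
  rw [norm_mul, norm_prod]
  refine mul_le_of_le_one_right (norm_nonneg _) (Finset.prod_le_one (fun _ _ => norm_nonneg _) ?_)
  intro i _
  rw [norm_pow]
  exact pow_le_one₀ (norm_nonneg _) (norm_apply_le_one_of_lpNorm_le_one hp hy i)

/-- The polar form, multiplied by the factorial of `m`, of the polynomial
`∑ α ∈ s, a α * ∏ k, X (f α k)`. -/
noncomputable def scaledPolarForm {ι 𝕂 : Type*} [RCLike 𝕂] {m n : ℕ} (s : Finset ι) (a : ι → 𝕂)
    (f : ι → Fin m → Fin n) : MultilinearMap 𝕂 (fun _ : Fin m => Fin n → 𝕂) 𝕂 :=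
  ∑ α ∈ s, a α • ∑ σ : Equiv.Perm (Fin m),
    (MultilinearMap.mkPiAlgebra 𝕂 (Fin m) 𝕂).compLinearMap
      (fun k => LinearMap.proj (f α (σ k)))

theorem scaledPolarForm_apply {ι 𝕂 : Type*} [RCLike 𝕂] {m n : ℕ} (s : Finset ι) (a : ι → 𝕂)
    (f : ι → Fin m → Fin n) (x : Fin m → Fin n → 𝕂) :
    scaledPolarForm s a f x
      = ∑ α ∈ s, a α * ∑ σ : Equiv.Perm (Fin m), ∏ k, x k (f α (σ k)) := by
  simp [scaledPolarForm]

theorem scaledPolarForm_single {ι 𝕂 : Type*} [RCLike 𝕂] {m n : ℕ} (s : Finset ι) (a : ι → 𝕂)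
    (f : ι → Fin m → Fin n) (j : Fin m → Fin n) :
    scaledPolarForm s a f (fun k => Pi.single (j k) 1)
      = ∑ α ∈ s, a α *
        ((Finset.univ.filter fun σ : Equiv.Perm (Fin m) => j = f α ∘ σ).card : 𝕂) := by
  rw [scaledPolarForm_apply]
  refine Finset.sum_congr rfl fun α _ => ?_
  congr 1
  rw [Finset.card_filter]
  push_cast
  refine Finset.sum_congr rfl fun σ _ => ?_
  simp [Pi.single_apply, Finset.prod_ite_zero, funext_iff, eq_comm]

theorem eval_eq_sum_coeff_mul_prod {σ R : Type*} [CommRing R] {m : ℕ} (P : MvPolynomial σ R)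
    (f : (σ →₀ ℕ) → Fin m → σ) (hf : ∀ α ∈ P.support, ∑ k, Finsupp.single (f α k) 1 = α)
    (y : σ → R) :
    MvPolynomial.eval y P = ∑ α ∈ P.support, P.coeff α * ∏ k, y (f α k) := by
  classical
  rw [MvPolynomial.eval_eq]
  refine Finset.sum_congr rfl fun α hα => ?_
  congr 1
  conv_lhs => rw [← Finsupp.prod, ← hf α hα]
  rw [← Finsupp.prod_finsetSum_index (by simp) (by intros; rw [pow_add])]
  simp

theorem two_pow_mul_scaledPolarForm {𝕂 : Type*} [RCLike 𝕂] {m n : ℕ} (P : MvPolynomial (Fin n) 𝕂)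
    (f : (Fin n →₀ ℕ) → Fin m → Fin n)
    (hf : ∀ α ∈ P.support, ∑ k, Finsupp.single (f α k) 1 = α) (x : Fin m → Fin n → 𝕂) :
    2 ^ m * scaledPolarForm P.support P.coeff f x
      = ∑ ε : Fin m → ℤˣ, (∏ k, ((ε k : ℤ) : 𝕂)) *
          MvPolynomial.eval (fun i => ∑ k, ((ε k : ℤ) : 𝕂) * x k i) P := by
  simp_rw [eval_eq_sum_coeff_mul_prod P f hf, Finset.mul_sum]
  rw [Finset.sum_comm, scaledPolarForm_apply, Finset.mul_sum]
  refine Finset.sum_congr rfl fun α _ => ?_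
  have h := sum_signs_prod_mul_prod_sum (R := 𝕂) (fun l k => x l (f α k))
  rw [Fintype.card_fin] at h
  simp_rw [mul_left_comm _ (P.coeff α)]
  rw [← Finset.mul_sum, h]
  congr 2
  refine Fintype.sum_equiv (Equiv.inv _) _ _ fun σ => ?_
  exact Fintype.prod_equiv σ _ _ fun k => by simp

theorem multilinearNorm_scaledPolarForm_le {𝕂 : Type*} [RCLike 𝕂] {p : ℝ} (hp : 1 ≤ p) {m n : ℕ}
    (hm : 0 < m) (P : MvPolynomial (Fin n) 𝕂) (f : (Fin n →₀ ℕ) → Fin m → Fin n)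
    (hf : ∀ α ∈ P.support, ∑ k, Finsupp.single (f α k) 1 = α) :
    multilinearNorm 𝕂 p (scaledPolarForm P.support P.coeff f)
      ≤ (m : ℝ) ^ m * polyNorm 𝕂 p P := by
  have hm' : (m : 𝕂) ≠ 0 := by exact_mod_cast hm.ne'
  refine Real.sSup_le ?_ (mul_nonneg (by positivity) (polyNorm_nonneg p P))
  rintro _ ⟨x, hx, rfl⟩
  have hbound (ε : Fin m → ℤˣ) : ‖(∏ k, ((ε k : ℤ) : 𝕂)) *
      MvPolynomial.eval (fun i => ∑ k, ((ε k : ℤ) : 𝕂) * x k i) P‖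
        ≤ (m : ℝ) ^ m * polyNorm 𝕂 p P := by
    have hscale : MvPolynomial.eval (fun i => ∑ k, ((ε k : ℤ) : 𝕂) * x k i) P
        = (m : 𝕂) ^ m *
          MvPolynomial.eval (fun i => (m : 𝕂)⁻¹ * ∑ k, ((ε k : ℤ) : 𝕂) * x k i) P := by
      simp_rw [eval_eq_sum_coeff_mul_prod P f hf, Finset.mul_sum (s := P.support)]
      refine Finset.sum_congr rfl fun α _ => ?_
      rw [Finset.prod_mul_distrib, Finset.prod_const, Finset.card_univ, Fintype.card_fin, inv_pow,
        mul_left_comm, mul_inv_cancel_left₀ (pow_ne_zero m hm')]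
    have hε : ‖∏ k, ((ε k : ℤ) : 𝕂)‖ = 1 := by
      rw [norm_prod]
      refine Finset.prod_eq_one fun k _ => ?_
      rcases Int.units_eq_one_or (ε k) with h | h <;> simp [h]
    rw [norm_mul, hε, one_mul, hscale, norm_mul, norm_pow, RCLike.norm_natCast]
    gcongr
    exact norm_eval_le_polyNorm (by linarith) P (lpNorm_average_le_one hp hm x hx ε)
  have h2 : (2 : ℝ) ^ m * ‖scaledPolarForm P.support P.coeff f x‖
      ≤ 2 ^ m * ((m : ℝ) ^ m * polyNorm 𝕂 p P) := by
    calc _ = ‖(2 : 𝕂) ^ m * scaledPolarForm P.support P.coeff f x‖ := by simp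
      _ ≤ ∑ ε : Fin m → ℤˣ, (m : ℝ) ^ m * polyNorm 𝕂 p P := by
        rw [two_pow_mul_scaledPolarForm P f hf]
        exact norm_sum_le_of_le _ fun ε _ => hbound ε
      _ = _ := by simp
  exact le_of_mul_le_mul_left h2 (by positivity)

/-- The coefficients of the scaled polar form dominate those of the polynomial. -/
theorem factorial_mul_sum_le {𝕂 : Type*} [RCLike 𝕂] {m n : ℕ} {r : ℝ} (hr : 1 ≤ r)
    (s : Finset (Fin n →₀ ℕ)) (a : (Fin n →₀ ℕ) → 𝕂) (f : (Fin n →₀ ℕ) → Fin m → Fin n)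
    (hf : ∀ α ∈ s, ∑ k, Finsupp.single (f α k) 1 = α) :
    (m.factorial : ℝ) * ∑ α ∈ s, ‖a α‖ ^ r
      ≤ ∑ j : Fin m → Fin n, ‖scaledPolarForm s a f (fun k => Pi.single (j k) 1)‖ ^ r := by
  classical
  let N (α : Fin n →₀ ℕ) (j : Fin m → Fin n) : ℕ :=
    (Finset.univ.filter fun σ : Equiv.Perm (Fin m) => j = f α ∘ σ).card
  have hN (α : Fin n →₀ ℕ) : ∑ j, (N α j : ℝ) = m.factorial := by
    have : ∑ j, N α j = m.factorial := by
      simp only [N, Finset.card_filter]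
      rw [Finset.sum_comm]
      simp [Fintype.card_perm]
    exact_mod_cast this
  have htype {α : Fin n →₀ ℕ} (hα : α ∈ s) {j : Fin m → Fin n} (h : N α j ≠ 0) :
      ∑ k, Finsupp.single (j k) 1 = α := by
    obtain ⟨σ, hσ⟩ := Finset.card_ne_zero.1 h
    rw [(Finset.mem_filter.1 hσ).2]
    refine Eq.trans ?_ (hf α hα)
    exact Equiv.sum_comp σ fun k => Finsupp.single (f α k) 1
  have hj (j : Fin m → Fin n) : ∑ α ∈ s, ‖a α‖ ^ r * N α j
      ≤ ‖scaledPolarForm s a f (fun k => Pi.single (j k) 1)‖ ^ r := by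
    rw [scaledPolarForm_single]
    change _ ≤ ‖∑ α ∈ s, a α * (N α j : 𝕂)‖ ^ r
    by_cases h : ∃ β ∈ s, N β j ≠ 0
    · obtain ⟨β, hβ, hβj⟩ := h
      have hz (α : Fin n →₀ ℕ) (hα : α ∈ s) (hne : α ≠ β) : N α j = 0 := by
        by_contra h0
        exact hne ((htype hα h0).symm.trans (htype hβ hβj))
      rw [Finset.sum_eq_single_of_mem β hβ fun α hα hne => by simp [hz α hα hne],
        Finset.sum_eq_single_of_mem β hβ fun α hα hne => by simp [hz α hα hne],
        norm_mul, RCLike.norm_natCast, Real.mul_rpow (by positivity) (by positivity)]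
      gcongr
      exact Real.self_le_rpow_of_one_le (by exact_mod_cast Nat.one_le_iff_ne_zero.2 hβj) hr
    · push Not at h
      rw [Finset.sum_eq_zero fun α hα => by simp [h α hα]]
      positivity
  calc _ = ∑ j : Fin m → Fin n, ∑ α ∈ s, ‖a α‖ ^ r * N α j := by
        rw [Finset.sum_comm]
        simp_rw [← Finset.mul_sum, hN]
        rw [← Finset.sum_mul, mul_comm]
    _ ≤ _ := Finset.sum_le_sum fun j _ => hj j

theorem polynomial_HL_from_multilinear_HL
    (𝕂 : Type*) [RCLike 𝕂] (m : ℕ) (hm : 2 ≤ m) (p : ℝ)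
    (hp1 : (m : ℝ) < p) (hp2 : p < 2 * m) (C : ℝ) (hC : 1 ≤ C)
    (hmult : ∀ n : ℕ, 0 < n → ∀ T : MultilinearMap 𝕂 (fun _ : Fin m => Fin n → 𝕂) 𝕂,
      (∑ j : Fin m → Fin n, ‖T (fun k => Pi.single (j k) (1 : 𝕂))‖ ^ (p / (p - m))) ^ ((p - m) / p)
        ≤ C * multilinearNorm 𝕂 p T) :
    ∀ n : ℕ, 0 < n → ∀ P : MvPolynomial (Fin n) 𝕂, P.IsHomogeneous m →
      (∑ α ∈ P.support, ‖MvPolynomial.coeff α P‖ ^ (p / (p - m))) ^ ((p - m) / p)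
        ≤ C * ((m : ℝ) ^ m / (m.factorial : ℝ) ^ ((p - m) / p)) * polyNorm 𝕂 p P := by
  intro n hn P hP
  have hm2 : (2 : ℝ) ≤ m := by exact_mod_cast hm
  have hpm : 0 < p - m := by linarith
  have hr : 1 ≤ p / (p - m) := by rw [le_div_iff₀ hpm]; linarith
  have hexp : 0 ≤ (p - m) / p := div_nonneg hpm.le (by linarith)
  have hfact : (0 : ℝ) < (m.factorial : ℝ) ^ ((p - m) / p) := by positivity
  have hex (α : Fin n →₀ ℕ) :
      ∃ f : Fin m → Fin n, α ∈ P.support → ∑ k, Finsupp.single (f k) 1 = α := by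
    by_cases hα : α ∈ P.support
    · obtain ⟨f, hf⟩ := exists_sum_single_eq α (m := m)
        (by rw [Finsupp.degree_eq_weight_one]; exact hP (MvPolynomial.mem_support_iff.1 hα))
      exact ⟨f, fun _ => hf⟩
    · exact ⟨fun _ => ⟨0, hn⟩, fun h => absurd h hα⟩
  choose f hf using hex
  have hsum : 0 ≤ ∑ α ∈ P.support, ‖P.coeff α‖ ^ (p / (p - m)) :=
    Finset.sum_nonneg fun _ _ => by positivity
  have h1 := Real.rpow_le_rpow (by positivity)
    (factorial_mul_sum_le hr P.support P.coeff f hf) hexp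
  rw [Real.mul_rpow (by positivity) hsum] at h1
  have h2 := h1.trans (hmult n hn (scaledPolarForm P.support P.coeff f))
  have h3 := multilinearNorm_scaledPolarForm_le (by linarith : 1 ≤ p) (by omega : 0 < m) P f hf
  have h4 := h2.trans (mul_le_mul_of_nonneg_left h3 (by linarith : 0 ≤ C))
  calc _ ≤ C * ((m : ℝ) ^ m * polyNorm 𝕂 p P) / (m.factorial : ℝ) ^ ((p - m) / p) := by
        rw [le_div_iff₀ hfact, mul_comm]; exact h4
    _ = _ := by ring
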